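/- arXiv:1009.0836 — 2 statements merged into one kernel-verified Lean document; each statement's English description precedes it below -/
import Mathlib

section
/- Let ξ0 : V × V × ℝ → ℝ be the continuous linear functional ξ0(z,w,s) = s, and for g ∈ H(V,A) let Ad(g) denote the conjugation map h ↦ g ∗ h ∗ g⁻¹. Then the map Φ : V × V → (V × V × ℝ)* sending (x,y) to the continuous linear functional ξ0 ∘ Ad((x,y,0)), which is given explicitly by (z,w,s) ↦ s + (A x | w) − (A z | y), is injective, and its range equals the full coadjoint orbit {ξ0 ∘ Ad(g) : g ∈ H(V,A)} of ξ0. Hence Φ is a bijection from V × V (identified with Ker ξ0 = V × V × {0}) onto the coadjoint orbit of ξ0, and the isotropy of the coadjoint action at ξ0 is exactly the center {0} × {0} × ℝ (the orbit is flat). -/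
open scoped RealInnerProductSpace

/-- The Heisenberg multiplication on `V × V × ℝ` associated with the operator `A`. -/
noncomputable def heisenbergMul {V : Type*} [NormedAddCommGroup V] [InnerProductSpace ℝ V]
    (A : V →L[ℝ] V) (g h : V × V × ℝ) : V × V × ℝ :=
  (g.1 + h.1, g.2.1 + h.2.1,
    g.2.2 + h.2.2 + (⟪A g.1, h.2.1⟫ - ⟪A h.1, g.2.1⟫) / 2)

/-- Conjugation `Ad(g)h = g ∗ h ∗ g⁻¹` in the Heisenberg group `H(V,A)`. -/
noncomputable def heisenbergAd {V : Type*} [NormedAddCommGroup V] [InnerProductSpace ℝ V]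
    (A : V →L[ℝ] V) (g h : V × V × ℝ) : V × V × ℝ :=
  heisenbergMul A (heisenbergMul A g h) (-g.1, -g.2.1, -g.2.2)

/-- The linear functional `ξ0(z,w,s) = s` on the Heisenberg algebra. -/
def heisenbergXi {V : Type*} (p : V × V × ℝ) : ℝ := p.2.2

/-- The map `Φ(x,y) = ξ0 ∘ Ad((x,y,0))`. -/
noncomputable def heisenbergPhi {V : Type*} [NormedAddCommGroup V] [InnerProductSpace ℝ V]
    (A : V →L[ℝ] V) (q : V × V) : (V × V × ℝ) → ℝ :=
  fun p => p.2.2 + ⟪A q.1, p.2.1⟫ - ⟪A p.1, q.2⟫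

/-- The functional `ξ0 ∘ Ad(g)` depends only on the first two components of `g`. -/
theorem heisenbergXi_comp_heisenbergAd {V : Type*} [NormedAddCommGroup V] [InnerProductSpace ℝ V]
    (A : V →L[ℝ] V) (g : V × V × ℝ) :
    heisenbergXi ∘ heisenbergAd A g = heisenbergPhi A (g.1, g.2.1) := by
  funext p
  simp only [Function.comp_apply, heisenbergXi, heisenbergAd, heisenbergMul, heisenbergPhi,
    map_add, map_neg, inner_add_left, inner_neg_left, inner_add_right, inner_neg_right]
  ring

theorem isLinearMap_heisenbergPhi {V : Type*} [NormedAddCommGroup V] [InnerProductSpace ℝ V]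
    (A : V →L[ℝ] V) (q : V × V) : IsLinearMap ℝ (heisenbergPhi A q) where
  map_add p r := by
    simp only [heisenbergPhi, Prod.fst_add, Prod.snd_add, map_add, inner_add_left,
      inner_add_right]
    ring
  map_smul c p := by
    simp only [heisenbergPhi, Prod.smul_fst, Prod.smul_snd, map_smul, real_inner_smul_left,
      real_inner_smul_right, smul_eq_mul]
    ring

theorem continuous_heisenbergPhi {V : Type*} [NormedAddCommGroup V] [InnerProductSpace ℝ V]
    (A : V →L[ℝ] V) (q : V × V) : Continuous (heisenbergPhi A q) := by
  unfold heisenbergPhi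
  fun_prop

theorem heisenbergPhi_injective {V : Type*} [NormedAddCommGroup V] [InnerProductSpace ℝ V]
    {A : V →L[ℝ] V} (hsym : ∀ x y : V, ⟪A x, y⟫ = ⟪x, A y⟫) (hinj : Function.Injective A) :
    Function.Injective (heisenbergPhi A) := by
  rintro ⟨x, y⟩ ⟨x', y'⟩ h
  have hx : A x = A x' := ext_inner_right ℝ fun w => by
    simpa [heisenbergPhi] using congrFun h (0, w, 0)
  have hy : A y = A y' := ext_inner_left ℝ fun z => by
    simpa [heisenbergPhi, hsym] using congrFun h (z, 0, 0)
  rw [hinj hx, hinj hy]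

theorem heisenbergPhi_zero {V : Type*} [NormedAddCommGroup V] [InnerProductSpace ℝ V]
    (A : V →L[ℝ] V) : heisenbergPhi A (0, 0) = heisenbergXi := by
  funext p
  simp [heisenbergPhi, heisenbergXi]

/-- `Φ : V × V → (V × V × ℝ)*`, `Φ(x,y) = ξ0 ∘ Ad((x,y,0))`, takes values in the continuous
linear functionals, is injective, its range is the full coadjoint orbit of `ξ0`, and the
isotropy of the coadjoint action at `ξ0` is exactly the center `{0} × {0} × ℝ`
(the orbit is flat). -/
theorem heisenberg_coadjoint_orbit_flat {V : Type*} [NormedAddCommGroup V]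
    [InnerProductSpace ℝ V] (A : V →L[ℝ] V)
    (hsym : ∀ x y : V, ⟪A x, y⟫ = ⟪x, A y⟫) (hinj : Function.Injective A) :
    (∀ x y : V, heisenbergPhi A (x, y)
        = heisenbergXi ∘ heisenbergAd A ((x, y, (0 : ℝ)) : V × V × ℝ)) ∧
    (∀ q : V × V, Continuous (heisenbergPhi A q) ∧ IsLinearMap ℝ (heisenbergPhi A q)) ∧
    Function.Injective (heisenbergPhi A (V := V)) ∧
    Set.range (heisenbergPhi A (V := V))
      = {f : (V × V × ℝ) → ℝ | ∃ g : V × V × ℝ, f = heisenbergXi ∘ heisenbergAd A g} ∧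
    {g : V × V × ℝ | heisenbergXi ∘ heisenbergAd A g = heisenbergXi (V := V)}
      = {g : V × V × ℝ | g.1 = 0 ∧ g.2.1 = 0} := by
  refine ⟨fun x y => (heisenbergXi_comp_heisenbergAd A (x, y, 0)).symm,
    fun q => ⟨continuous_heisenbergPhi A q, isLinearMap_heisenbergPhi A q⟩,
    heisenbergPhi_injective hsym hinj, ?_, ?_⟩
  · ext f
    simp only [Set.mem_range, Set.mem_ofPred_eq, heisenbergXi_comp_heisenbergAd A]
    exact ⟨fun ⟨q, hq⟩ => ⟨(q.1, q.2, 0), hq.symm⟩, fun ⟨g, hg⟩ => ⟨(g.1, g.2.1), hg.symm⟩⟩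
  · ext g
    rw [Set.mem_ofPred_eq, Set.mem_ofPred_eq, heisenbergXi_comp_heisenbergAd A,
      ← heisenbergPhi_zero A, (heisenbergPhi_injective hsym hinj).eq_iff, Prod.mk.injEq]
end

section
/- Let ξ0 : V × V × ℝ → ℝ be the linear functional ξ0(z,w,s) = s and let Ad(g)h = g ∗ h ∗ g⁻¹. If two elements ξ1 = ξ0 ∘ Ad(g1) and ξ2 = ξ0 ∘ Ad(g2) of the coadjoint orbit of ξ0 agree on the subspace Ξ := V × V × {0} (i.e. ξ1(z,w,0) = ξ2(z,w,0) for all z,w ∈ V), then ξ1 = ξ2. In other words, Ξ = V × V × {0}, with the inclusion map into V × V × ℝ, is a predual for the coadjoint orbit of ξ0: the restriction map ξ ↦ ξ|_Ξ is injective on the orbit. -/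
open scoped RealInnerProductSpace

/-- The coadjoint orbit of `ξ0`: `(ξ0 ∘ Ad(g))(z,w,s) = s + (A x | w) - (A z | y)` for
`g = (x,y,t)`. -/
theorem heisenbergXi_heisenbergAd {V : Type*} [NormedAddCommGroup V] [InnerProductSpace ℝ V]
    (A : V →L[ℝ] V) (g h : V × V × ℝ) :
    heisenbergXi (heisenbergAd A g h) = h.2.2 + ⟪A g.1, h.2.1⟫ - ⟪A h.1, g.2.1⟫ := by
  simp only [heisenbergXi, heisenbergAd, heisenbergMul, map_add, map_neg, inner_add_left,
    inner_add_right, inner_neg_left, inner_neg_right]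
  ring

/-- If two elements `ξ0 ∘ Ad(g₁)` and `ξ0 ∘ Ad(g₂)` of the coadjoint orbit of `ξ0` agree on
the subspace `Ξ = V × V × {0}`, then they are equal: `Ξ` is a predual for the coadjoint
orbit of `ξ0`. -/
theorem heisenberg_predual_injective {V : Type*} [NormedAddCommGroup V]
    [InnerProductSpace ℝ V] (A : V →L[ℝ] V)
    (hsym : ∀ x y : V, ⟪A x, y⟫ = ⟪x, A y⟫) (hinj : Function.Injective A) :
    ∀ g₁ g₂ : V × V × ℝ,
      (∀ z w : V,
        heisenbergXi (heisenbergAd A g₁ (z, w, (0 : ℝ)))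
          = heisenbergXi (heisenbergAd A g₂ (z, w, (0 : ℝ)))) →
      heisenbergXi ∘ heisenbergAd A g₁ = heisenbergXi ∘ heisenbergAd A g₂ := by
  intro g₁ g₂ hagree
  funext ⟨z, w, s⟩
  have hzw := hagree z w
  simp only [Function.comp_apply, heisenbergXi_heisenbergAd] at hzw ⊢
  linarith
end
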